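/- If in addition L·d²·sup_{t≥0} 𝔼[R(t,·)] < λ, then there exists u ∈ 𝓜 such that for every t ∈ ℝ, K^h(u)(t,·) = u(t,·) ℙ-almost surely, and u is the unique such fixed point up to ρ: any v ∈ 𝓜 with K^h(v)(t,·) = v(t,·) ℙ-a.s. for every t satisfies ρ(u, v) = 0. -/

import Mathlib

open MeasureTheory Filter
open scoped ENNReal Topology

section CountableL1Net

variable {ι Ω E : Type*} [MeasurableSpace Ω] [NormedAddCommGroup E]
  [MeasurableSpace E]

/-- The random variables `X t` can be approximated in `L¹(μ)` by countably many ones. -/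
def HasCountableL1Net (μ : Measure Ω) (X : ι → Ω → E) : Prop :=
  ∃ g : ℕ → Ω → E, (∀ k, Measurable (g k)) ∧
    ∀ t, ∀ ε : ℝ≥0∞, 0 < ε → ∃ k, ∫⁻ ω, ‖X t ω - g k ω‖ₑ ∂μ < ε

theorem HasCountableL1Net.zero {μ : Measure Ω} :
    HasCountableL1Net μ fun (_ : ι) _ => (0 : E) :=
  ⟨fun _ _ => 0, fun _ => measurable_const, fun _ ε hε => ⟨0, by simpa using hε⟩⟩

variable [BorelSpace E] [SecondCountableTopology E]

theorem lintegral_enorm_sub_le_add {μ : Measure Ω} {f g k : Ω → E} (hf : Measurable f)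
    (hg : Measurable g) :
    ∫⁻ ω, ‖f ω - k ω‖ₑ ∂μ ≤ ∫⁻ ω, ‖f ω - g ω‖ₑ ∂μ + ∫⁻ ω, ‖g ω - k ω‖ₑ ∂μ := by
  rw [← lintegral_add_left (f := fun ω => ‖f ω - g ω‖ₑ) (hf.sub hg).enorm]
  refine lintegral_mono fun ω => ?_
  calc ‖f ω - k ω‖ₑ = ‖(f ω - g ω) + (g ω - k ω)‖ₑ := by rw [sub_add_sub_cancel]
    _ ≤ _ := enorm_add_le _ _

namespace HasCountableL1Net

variable {μ : Measure Ω} {X Y : ι → Ω → E}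

theorem add (hX : HasCountableL1Net μ X) (hY : HasCountableL1Net μ Y)
    (hXm : ∀ t, Measurable (X t)) :
    HasCountableL1Net μ fun t ω => X t ω + Y t ω := by
  obtain ⟨g, hg, hgX⟩ := hX
  obtain ⟨k, hk, hkY⟩ := hY
  refine ⟨fun n ω => g n.unpair.1 ω + k n.unpair.2 ω, fun n => (hg _).add (hk _),
    fun t ε hε => ?_⟩
  obtain ⟨a, ha⟩ := hgX t (ε / 2) (ENNReal.half_pos hε.ne')
  obtain ⟨b, hb⟩ := hkY t (ε / 2) (ENNReal.half_pos hε.ne')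
  refine ⟨Nat.pair a b, ?_⟩
  simp only [Nat.unpair_pair]
  calc ∫⁻ ω, ‖X t ω + Y t ω - (g a ω + k b ω)‖ₑ ∂μ
      ≤ ∫⁻ ω, (‖X t ω - g a ω‖ₑ + ‖Y t ω - k b ω‖ₑ) ∂μ := by
        refine lintegral_mono fun ω => ?_
        rw [add_sub_add_comm]
        exact enorm_add_le _ _
    _ = ∫⁻ ω, ‖X t ω - g a ω‖ₑ ∂μ + ∫⁻ ω, ‖Y t ω - k b ω‖ₑ ∂μ :=
        lintegral_add_left ((hXm t).sub (hg a)).enorm _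
    _ < ε / 2 + ε / 2 := ENNReal.add_lt_add ha hb
    _ = ε := ENNReal.add_halves ε

theorem of_tendsto [IsFiniteMeasure μ] {Z : ℕ → ι → Ω → E} {C : ℝ}
    (hZ : ∀ n, HasCountableL1Net μ (Z n)) (hZm : ∀ n t, Measurable (Z n t))
    (hXm : ∀ t, Measurable (X t)) (hC : ∀ n t ω, ‖Z n t ω‖ ≤ C)
    (hlim : ∀ t ω, Tendsto (fun n => Z n t ω) atTop (𝓝 (X t ω))) :
    HasCountableL1Net μ X := by
  choose g hg hgZ using hZ
  refine ⟨fun n => g n.unpair.1 n.unpair.2, fun n => hg _ _, fun t ε hε => ?_⟩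
  have hXC : ∀ ω, ‖X t ω‖ ≤ C := fun ω =>
    le_of_tendsto (hlim t ω).norm (Eventually.of_forall fun n => hC n t ω)
  have key : Tendsto (fun n => ∫⁻ ω, ‖X t ω - Z n t ω‖ₑ ∂μ) atTop (𝓝 0) := by
    have := tendsto_lintegral_of_dominated_convergence (μ := μ)
      (F := fun n ω => ‖X t ω - Z n t ω‖ₑ) (f := fun _ => 0)
      (fun _ => ENNReal.ofReal (C + C)) (fun n => ((hXm t).sub (hZm n t)).enorm)
      (fun n => Eventually.of_forall fun ω => ?_) ?_ (Eventually.of_forall fun ω => ?_)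
    · simpa using this
    · beta_reduce
      rw [← ofReal_norm]
      exact ENNReal.ofReal_le_ofReal ((norm_sub_le _ _).trans (add_le_add (hXC ω) (hC n t ω)))
    · rw [lintegral_const]
      exact ENNReal.mul_ne_top ENNReal.ofReal_ne_top (measure_ne_top _ _)
    · have := (tendsto_const_nhds (x := X t ω)).sub (hlim t ω)
      simpa using this.enorm
  obtain ⟨n, hn⟩ := (key.eventually_lt_const (ENNReal.half_pos hε.ne')).exists
  obtain ⟨k, hk⟩ := hgZ n t (ε / 2) (ENNReal.half_pos hε.ne')
  refine ⟨Nat.pair n k, ?_⟩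
  simp only [Nat.unpair_pair]
  calc _ ≤ _ := lintegral_enorm_sub_le_add (hXm t) (hZm n t)
    _ < ε / 2 + ε / 2 := ENNReal.add_lt_add hn hk
    _ = ε := ENNReal.add_halves ε

theorem finset_sum {κ : Type*} (s : Finset κ) {Z : κ → ι → Ω → E}
    (hZ : ∀ n, HasCountableL1Net μ (Z n)) (hZm : ∀ n t, Measurable (Z n t)) :
    HasCountableL1Net μ fun t ω => ∑ n ∈ s, Z n t ω := by
  classical
  induction s using Finset.induction_on with
  | empty => simpa using zero
  | insert a s ha ih =>
    simp only [Finset.sum_insert ha]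
    exact (hZ a).add ih (hZm a)

theorem indicator [MeasurableSpace ι] [IsFiniteMeasure μ] (c : E) {A : Set (ι × Ω)} (hA : MeasurableSet A) :
    HasCountableL1Net μ fun t ω => A.indicator (fun _ => c) (t, ω) := by
  have meas : ∀ {B : Set (ι × Ω)}, MeasurableSet B → ∀ t,
      Measurable fun ω => B.indicator (fun _ => c) (t, ω) := fun hB t =>
    (measurable_const.indicator hB).comp measurable_prodMk_left
  induction A, hA using MeasurableSpace.induction_on_inter generateFrom_prod.symm
    isPiSystem_prod with
  | empty => simpa using zero
  | basic B hB =>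
    obtain ⟨S, hS, U, hU, rfl⟩ := hB
    refine ⟨fun k ω => if k = 0 then 0 else U.indicator (fun _ => c) ω, fun k => ?_,
      fun t ε hε => ?_⟩
    · by_cases hk : k = 0
      · simp [hk]
      · simpa [hk] using! (measurable_const (a := c)).indicator hU
    · by_cases ht : t ∈ S
      · refine ⟨1, ?_⟩
        have hU' : ∀ ω, (S ×ˢ U).indicator (fun _ => c) (t, ω) = U.indicator (fun _ => c) ω := by
          intro ω
          by_cases hω : ω ∈ U <;> simp [ht, hω]
        simpa [hU'] using hε
      · refine ⟨0, ?_⟩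
        simp [ht, hε]
  | compl B hB ih =>
    obtain ⟨g, hg, hgX⟩ := ih
    refine ⟨fun k ω => c - g k ω, fun k => (hg k).const_sub c, fun t ε hε => ?_⟩
    obtain ⟨k, hk⟩ := hgX t ε hε
    refine ⟨k, lt_of_eq_of_lt (lintegral_congr fun ω => ?_) hk⟩
    rw [← enorm_neg]
    congr 1
    by_cases hB : (t, ω) ∈ B <;> simp [hB]
  | iUnion f hdisj hf ih =>
    have hsum : ∀ n t ω, ∑ i ∈ Finset.range n, (f i).indicator (fun _ => c) (t, ω)
        = (⋃ i ∈ Finset.range n, f i).indicator (fun _ => c) (t, ω) := fun n t ω =>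
      (Finset.indicator_biUnion_apply _ _ (fun i _ j _ hij => hdisj hij) _).symm
    refine of_tendsto (Z := fun n t ω => ∑ i ∈ Finset.range n, (f i).indicator (fun _ => c) (t, ω))
      (C := ‖c‖) (fun n => finset_sum _ ih fun i t => meas (hf i) t)
      (fun n t => Finset.measurable_fun_sum _ fun i _ => meas (hf i) t)
      (meas (MeasurableSet.iUnion hf)) (fun n t ω => ?_) (fun t ω => ?_)
    · rw [hsum]
      exact norm_indicator_le_norm_self _ _
    · simp only [hsum]
      exact ((tendsto_indicator_biUnion_finset f (fun _ => c) (t, ω)).comp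
        tendsto_finset_range).mono_right (pure_le_nhds _)

theorem simpleFunc [MeasurableSpace ι] [IsFiniteMeasure μ] (F : SimpleFunc (ι × Ω) E) :
    HasCountableL1Net μ fun t ω => F (t, ω) := by
  induction F using SimpleFunc.induction with
  | const c hs => simpa [Set.piecewise_eq_indicator] using! indicator c hs
  | add _ hF hG => exact hF.add hG fun t => (SimpleFunc.measurable _).comp measurable_prodMk_left

theorem of_bounded [MeasurableSpace ι] [NormedSpace ℝ E] [IsFiniteMeasure μ]
    (hX : Measurable (Function.uncurry X)) {C : ℝ} (hC0 : 0 ≤ C)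
    (hC : ∀ t ω, ‖X t ω‖ ≤ C) : HasCountableL1Net μ X := by
  have hs : StronglyMeasurable (Function.uncurry X) := hX.stronglyMeasurable
  exact of_tendsto (Z := fun n t ω => hs.approxBounded C n (t, ω)) (C := C)
    (fun n => simpleFunc _)
    (fun n t => (SimpleFunc.measurable _).comp measurable_prodMk_left)
    (fun t => hX.comp measurable_prodMk_left)
    (fun n t ω => hs.norm_approxBounded_le hC0 n _)
    (fun t ω => hs.tendsto_approxBounded_of_norm_le (hC t ω))

end HasCountableL1Net

end CountableL1Net

theorem Set.exists_countable_coinitial_real (A : Set ℝ) :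
    ∃ Q ⊆ A, Q.Countable ∧ ∀ t ∈ A, ∃ q ∈ Q, q ≤ t := by
  obtain ⟨D, hDA, hD, hAD⟩ :=
    (TopologicalSpace.IsSeparable.of_separableSpace A).exists_countable_dense_subset
  refine ⟨D ∪ {a | IsLeast A a}, Set.union_subset hDA fun a ha => ha.1,
    hD.union (Set.Subsingleton.countable fun a ha b hb => IsLeast.unique ha hb), fun t ht => ?_⟩
  by_cases hmin : IsLeast A t
  · exact ⟨t, Or.inr hmin, le_rfl⟩
  · obtain ⟨b, hb, hbt⟩ : ∃ b ∈ A, b < t := by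
      by_contra! hcon
      exact hmin ⟨ht, hcon⟩
    obtain ⟨q, hqt, hq⟩ := mem_closure_iff.1 (hAD hb) (Set.Iio t) isOpen_Iio hbt
    exact ⟨q, Or.inl hq, (Set.mem_Iio.1 hqt).le⟩

section AdmissibleFunctions

variable {Ω : Type*} {mΩ : MeasurableSpace Ω} {d : ℕ}

theorem MeasureTheory.IsStronglyProgressive.measurable_uncurry {𝓕 : Filtration ℝ mΩ}
    {f : ℝ → Ω → Fin d → ℝ} (hf : IsStronglyProgressive 𝓕 f) :
    Measurable (Function.uncurry f) := by
  have hn : ∀ n : ℕ, Measurable fun p : ℝ × Ω => f (min p.1 n) p.2 := by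
    intro n
    have h1 : Measurable[Prod.instMeasurableSpace (m₁ := Subtype.instMeasurableSpace) (m₂ := mΩ)]
        fun p : Set.Iic (n : ℝ) × Ω => f p.1 p.2 :=
      (hf n).measurable.mono (sup_le_sup le_rfl (MeasurableSpace.comap_mono (𝓕.le n))) le_rfl
    exact h1.comp ((Measurable.subtype_mk (h := fun p : ℝ × Ω => min_le_right p.1 (n : ℝ))
      (measurable_fst.min measurable_const)).prodMk measurable_snd)
  refine measurable_of_tendsto_metrizable hn (tendsto_pi_nhds.2 fun p => ?_)
  obtain ⟨n, hn⟩ := exists_nat_ge p.1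
  refine tendsto_const_nhds.congr' ?_
  filter_upwards [eventually_ge_atTop n] with m hm
  have : p.1 ≤ m := hn.trans (by exact_mod_cast hm)
  simp [Function.uncurry, min_eq_left this]

/-- Progressively measurable processes with values in the box `[0, N]` which are `T`-periodic with
respect to the transformation `σ` of the probability space. -/
structure IsAdmissible (𝓕 : Filtration ℝ mΩ) (σ : Ω → Ω) (T : ℝ) (N : Fin d → ℝ)
    (f : ℝ → Ω → Fin d → ℝ) : Prop where
  progressive : IsStronglyProgressive 𝓕 f
  nonneg : ∀ t ω i, 0 ≤ f t ω i
  le_bound : ∀ t ω i, f t ω i ≤ N i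
  periodic : ∀ t ω, f (t + T) ω = f t (σ ω)

variable {𝓕 : Filtration ℝ mΩ} {σ : Ω → Ω} {T : ℝ} {N : Fin d → ℝ}

theorem pi_norm_le_of_nonneg_of_le {x : Fin d → ℝ} (h0 : ∀ i, 0 ≤ x i) (hN : ∀ i, x i ≤ N i) :
    ‖x‖ ≤ ‖N‖ := by
  refine (pi_norm_le_iff_of_nonneg (norm_nonneg _)).2 fun i => ?_
  rw [Real.norm_of_nonneg (h0 i)]
  exact (hN i).trans ((le_abs_self _).trans (norm_le_pi_norm N i))

theorem IsAdmissible.norm_le {f : ℝ → Ω → Fin d → ℝ} (hf : IsAdmissible 𝓕 σ T N f) (t : ℝ)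
    (ω : Ω) : ‖f t ω‖ ≤ ‖N‖ :=
  pi_norm_le_of_nonneg_of_le (hf.nonneg t ω) (hf.le_bound t ω)

theorem IsAdmissible.measurable {f : ℝ → Ω → Fin d → ℝ} (hf : IsAdmissible 𝓕 σ T N f) (t : ℝ) :
    Measurable (f t) :=
  ((hf.progressive.stronglyAdapted t).mono (𝓕.le t)).measurable

theorem stronglyMeasurable_pi_limsup {α : Type*} {_ : MeasurableSpace α}
    {F : ℕ → α → Fin d → ℝ} (hF : ∀ n, Measurable (F n)) :
    StronglyMeasurable fun a i => limsup (fun n => F n a i) atTop :=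
  (measurable_pi_lambda _ fun i => Measurable.limsup fun n =>
    (measurable_pi_apply i).comp (hF n)).stronglyMeasurable

theorem IsAdmissible.exists_limit {f : ℕ → ℝ → Ω → Fin d → ℝ}
    (hf : ∀ n, IsAdmissible 𝓕 σ T N (f n)) :
    ∃ g, IsAdmissible 𝓕 σ T N g ∧ ∀ t ω x, Tendsto (fun n => f n t ω) atTop (𝓝 x) →
      g t ω = x := by
  have hle : ∀ t ω i, IsBoundedUnder (· ≤ ·) atTop fun n => f n t ω i := fun t ω i =>
    isBoundedUnder_of ⟨N i, fun n => (hf n).le_bound t ω i⟩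
  have hge : ∀ t ω i, IsBoundedUnder (· ≥ ·) atTop fun n => f n t ω i := fun t ω i =>
    isBoundedUnder_of ⟨0, fun n => (hf n).nonneg t ω i⟩
  refine ⟨fun t ω i => limsup (fun n => f n t ω i) atTop, ⟨fun t => ?_, fun t ω i => ?_,
    fun t ω i => ?_, fun t ω => ?_⟩, fun t ω x hx => ?_⟩
  · exact stronglyMeasurable_pi_limsup fun n => ((hf n).progressive t).measurable
  · exact le_limsup_of_frequently_le (Frequently.of_forall fun n => (hf n).nonneg t ω i)
      (hle t ω i)
  · exact limsup_le_of_le (hge t ω i).isCoboundedUnder_le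
      (Eventually.of_forall fun n => (hf n).le_bound t ω i)
  · simp only [(hf _).periodic]
  · exact funext fun i => (tendsto_pi_nhds.1 hx i).limsup_eq

theorem ae_tendsto_of_tsum_lintegral_enorm_sub {μ : Measure Ω} {f : ℕ → Ω → Fin d → ℝ}
    {g : Ω → Fin d → ℝ} (hf : ∀ n, Measurable (f n)) (hg : Measurable g)
    (hsum : ∑' n, ∫⁻ ω, ‖f n ω - g ω‖ₑ ∂μ ≠ ∞) :
    ∀ᵐ ω ∂μ, Tendsto (fun n => f n ω) atTop (𝓝 (g ω)) := by
  have hm : ∀ n, Measurable fun ω => ‖f n ω - g ω‖ₑ := fun n => ((hf n).sub hg).enorm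
  rw [← lintegral_tsum fun n => (hm n).aemeasurable] at hsum
  filter_upwards [ae_lt_top (Measurable.tsum hm) hsum] with ω hω
  rw [tendsto_iff_edist_tendsto_0]
  simpa [edist_eq_enorm_sub] using ENNReal.tendsto_atTop_zero_of_tsum_ne_top hω.ne

theorem ae_cauchySeq_of_tsum_lintegral_enorm_sub {μ : Measure Ω} {f : ℕ → Ω → Fin d → ℝ}
    (hf : ∀ n, Measurable (f n))
    (hsum : ∑' n, ∫⁻ ω, ‖f (n + 1) ω - f n ω‖ₑ ∂μ ≠ ∞) :
    ∀ᵐ ω ∂μ, CauchySeq fun n => f n ω := by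
  have hm : ∀ n, Measurable fun ω => ‖f (n + 1) ω - f n ω‖ₑ := fun n =>
    ((hf _).sub (hf n)).enorm
  rw [← lintegral_tsum fun n => (hm n).aemeasurable] at hsum
  filter_upwards [ae_lt_top (Measurable.tsum hm) hsum] with ω hω
  refine cauchySeq_of_edist_le_of_tsum_ne_top _ (fun n => ?_) hω.ne
  rw [edist_comm, edist_eq_enorm_sub]

/-- A measurable, equivariant choice of times preceding `t` at which the process is `L¹`-close to
its value at time `t`, taking countably many values. -/
theorem exists_countable_valued_time_change {μ : Measure Ω} [IsFiniteMeasure μ]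
    {X : ℝ → Ω → Fin d → ℝ} {C : ℝ} (hT : 0 < T) (hX : Measurable (Function.uncurry X))
    (hC0 : 0 ≤ C) (hC : ∀ t ω, ‖X t ω‖ ≤ C) (hσ : MeasurePreserving σ μ μ)
    (hper : ∀ t ω, X (t + T) ω = X t (σ ω)) {ε : ℝ≥0∞} (hε : 0 < ε) :
    ∃ τ : ℝ → ℝ, Measurable τ ∧ (Set.range τ).Countable ∧ (∀ t, τ t ≤ t) ∧
      (∀ t, τ (t + T) = τ t + T) ∧ ∀ t, ∫⁻ ω, ‖X (τ t) ω - X t ω‖ₑ ∂μ < ε := by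
  have hXt : ∀ t, Measurable (X t) := fun t => hX.comp measurable_prodMk_left
  obtain ⟨g, hg, hgX⟩ := HasCountableL1Net.of_bounded (μ := μ) hX hC0 hC
  choose Q hQA hQc hQ using fun k => Set.exists_countable_coinitial_real
    {t | t ∈ Set.Ico 0 T ∧ ∫⁻ ω, ‖X t ω - g k ω‖ₑ ∂μ < ε / 2}
  have hcover : ∀ t ∈ Set.Ico 0 T, ∃ q ∈ ⋃ k, Q k, q ≤ t ∧ ∫⁻ ω, ‖X q ω - X t ω‖ₑ ∂μ < ε := by
    intro t ht
    obtain ⟨k, hk⟩ := hgX t (ε / 2) (ENNReal.half_pos hε.ne')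
    obtain ⟨q, hq, hqt⟩ := hQ k t ⟨ht, hk⟩
    refine ⟨q, Set.mem_iUnion.2 ⟨k, hq⟩, hqt, ?_⟩
    calc ∫⁻ ω, ‖X q ω - X t ω‖ₑ ∂μ
        ≤ ∫⁻ ω, ‖X q ω - g k ω‖ₑ ∂μ + ∫⁻ ω, ‖g k ω - X t ω‖ₑ ∂μ :=
          lintegral_enorm_sub_le_add (hXt q) (hg k)
      _ < ε / 2 + ε / 2 := by
          refine ENNReal.add_lt_add (hQA k hq).2 (lt_of_eq_of_lt ?_ hk)
          exact lintegral_congr fun ω => enorm_sub_rev _ _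
      _ = ε := ENNReal.add_halves ε
  obtain ⟨q, hqrange⟩ := (Set.countable_iUnion hQc).exists_eq_range
    (let ⟨q, hq, _⟩ := hcover 0 ⟨le_rfl, hT⟩; ⟨q, hq⟩)
  have hex : ∀ t, ∃ j, (q j ≤ t ∧ ∫⁻ ω, ‖X (q j) ω - X t ω‖ₑ ∂μ < ε) ∨ t ∉ Set.Ico 0 T := by
    intro t
    by_cases ht : t ∈ Set.Ico 0 T
    · obtain ⟨p, hp, hpt⟩ := hcover t ht
      rw [hqrange] at hp
      obtain ⟨j, rfl⟩ := hp
      exact ⟨j, Or.inl hpt⟩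
    · exact ⟨0, Or.inr ht⟩
  classical
  have hδ : ∀ s, Measurable fun t => ∫⁻ ω, ‖X s ω - X t ω‖ₑ ∂μ := fun s =>
    Measurable.lintegral_prod_right' (f := fun p : ℝ × Ω => ‖X s p.2 - X p.1 p.2‖ₑ)
      (((hXt s).comp measurable_snd).sub hX).enorm
  have hJ : Measurable fun t => Nat.find (hex t) := measurable_find hex fun j =>
    ((measurableSet_le measurable_const measurable_id).inter
      (measurableSet_lt (hδ (q j)) measurable_const)).union measurableSet_Ico.compl
  set τ₀ : ℝ → ℝ := fun t => q (Nat.find (hex t)) with hτ₀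
  have hτ₀m : Measurable τ₀ := (measurable_from_top (f := q)).comp hJ
  have hτ₀s : ∀ t ∈ Set.Ico 0 T, τ₀ t ≤ t ∧ ∫⁻ ω, ‖X (τ₀ t) ω - X t ω‖ₑ ∂μ < ε := fun t ht =>
    (Nat.find_spec (hex t)).resolve_right (not_not.2 ht)
  have hfl : Measurable fun t : ℝ => (⌊t / T⌋ : ℝ) * T :=
    ((measurable_from_top (f := fun n : ℤ => (n : ℝ))).comp
      (Int.measurable_floor.comp (measurable_id.div_const T))).mul_const T
  have hr : ∀ t : ℝ, t - ⌊t / T⌋ * T ∈ Set.Ico 0 T := fun t => by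
    have h1 := Int.floor_le (t / T)
    have h2 := Int.lt_floor_add_one (t / T)
    rw [le_div_iff₀ hT] at h1
    rw [div_lt_iff₀ hT] at h2
    constructor <;> linarith
  refine ⟨fun t => τ₀ (t - ⌊t / T⌋ * T) + ⌊t / T⌋ * T,
    (hτ₀m.comp (measurable_id.sub hfl)).add hfl, ?_, fun t => ?_, fun t => ?_, fun t => ?_⟩
  · refine (Set.countable_range fun p : ℕ × ℤ => q p.1 + p.2 * T).mono ?_
    rintro _ ⟨t, rfl⟩
    exact ⟨(_, ⌊t / T⌋), rfl⟩
  · linarith [(hτ₀s _ (hr t)).1]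
  · have : (t + T) / T = t / T + 1 := by field_simp
    beta_reduce
    rw [this, Int.floor_add_one]
    push_cast
    rw [show t + T - (⌊t / T⌋ + 1) * T = t - ⌊t / T⌋ * T by ring]
    ring
  · set r := t - ⌊t / T⌋ * T with hrdef
    have hP : Function.Periodic (fun x => ∫⁻ ω, ‖X (τ₀ r + x) ω - X (r + x) ω‖ₑ ∂μ) T := by
      intro x
      simp only [← add_assoc, hper]
      exact hσ.lintegral_comp (((hXt _).sub (hXt _)).enorm)
    have := hP.int_mul_eq ⌊t / T⌋
    simp only [add_zero] at this
    rw [show r + ⌊t / T⌋ * T = t by rw [hrdef]; ring] at this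
    rw [this]
    exact (hτ₀s r (hr t)).2

theorem isStronglyProgressive_comp_countable_range {X : ℝ → Ω → Fin d → ℝ} {τ : ℝ → ℝ}
    (hX : ∀ t, Measurable[𝓕 t] (X t)) (hτ : Measurable τ) (hτc : (Set.range τ).Countable)
    (hτle : ∀ t, τ t ≤ t) : IsStronglyProgressive 𝓕 fun t => X (τ t) := by
  intro t
  refine @Measurable.stronglyMeasurable _ _ (_) _ _ _ _ _ _ ?_
  intro U hU
  have : (fun p : Set.Iic t × Ω => X (τ p.1) p.2) ⁻¹' U
      = ⋃ c ∈ Set.range τ ∩ Set.Iic t, ((fun s : Set.Iic t => τ s) ⁻¹' {c}) ×ˢ (X c ⁻¹' U) := by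
    ext p
    simp only [Set.mem_preimage, Set.mem_iUnion, Set.mem_prod, Set.mem_singleton_iff]
    constructor
    · exact fun hp => ⟨τ p.1, ⟨⟨_, rfl⟩, (hτle _).trans p.1.2⟩, rfl, hp⟩
    · rintro ⟨c, _, hc, hp⟩
      rwa [hc]
  rw [this]
  refine MeasurableSet.biUnion (hτc.mono Set.inter_subset_left) fun c hc => ?_
  refine @MeasurableSet.prod _ _ _ (𝓕 t) _ _ ?_ ?_
  · exact (hτ.comp measurable_subtype_coe) (measurableSet_singleton c)
  · exact 𝓕.mono hc.2 _ (hX c hU)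

theorem exists_admissible_modification {μ : Measure Ω} [IsFiniteMeasure μ]
    {X : ℝ → Ω → Fin d → ℝ} (hT : 0 < T) (hX : Measurable (Function.uncurry X))
    (hadapt : ∀ t, Measurable[𝓕 t] (X t)) (h0 : ∀ t ω i, 0 ≤ X t ω i)
    (hN : ∀ t ω i, X t ω i ≤ N i) (hσ : MeasurePreserving σ μ μ)
    (hper : ∀ t ω, X (t + T) ω = X t (σ ω)) :
    ∃ Y, IsAdmissible 𝓕 σ T N Y ∧ ∀ t, ∀ᵐ ω ∂μ, Y t ω = X t ω := by
  choose τ hτ hτc hτle hτT hτX using fun n : ℕ =>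
    exists_countable_valued_time_change (μ := μ) hT hX (norm_nonneg N)
      (fun t ω => pi_norm_le_of_nonneg_of_le (h0 t ω) (hN t ω)) hσ hper
      (ε := (2⁻¹ : ℝ≥0∞) ^ n) (ENNReal.pow_pos (by simp) n)
  obtain ⟨Y, hY, hYlim⟩ := IsAdmissible.exists_limit (𝓕 := 𝓕) (σ := σ) (T := T) (N := N)
    (f := fun n t => X (τ n t)) fun n =>
      ⟨isStronglyProgressive_comp_countable_range hadapt (hτ n) (hτc n) (hτle n),
        fun t ω i => h0 _ ω i, fun t ω i => hN _ ω i, fun t ω => by rw [hτT, hper]⟩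
  refine ⟨Y, hY, fun t => ?_⟩
  have hXt : ∀ t, Measurable (X t) := fun t => hX.comp measurable_prodMk_left
  have hsum : ∑' n, ∫⁻ ω, ‖X (τ n t) ω - X t ω‖ₑ ∂μ ≠ ∞ := by
    refine ne_top_of_le_ne_top ?_ (ENNReal.tsum_le_tsum fun n => (hτX n t).le)
    rw [ENNReal.tsum_geometric]
    simp
  filter_upwards [ae_tendsto_of_tsum_lintegral_enorm_sub (fun n => hXt _) (hXt t) hsum] with ω hω
  exact hYlim t ω _ hω

end AdmissibleFunctions

section GainOperator

variable {Ω : Type*} {mΩ : MeasurableSpace Ω} {d : ℕ}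

/-- The operator `v ↦ ∫_{-∞}^t Φ(t - s, θ_s ω) v(s, ω) ds`. -/
noncomputable def gainOperator (Φ : ℝ → Ω → Matrix (Fin d) (Fin d) ℝ) (θ : ℝ → Ω → Ω)
    (v : ℝ → Ω → Fin d → ℝ) (t : ℝ) (ω : Ω) : Fin d → ℝ :=
  ∫ s in Set.Iic t, (Φ (t - s) (θ s ω)).mulVec (v s ω)

theorem norm_mulVec_le_of_entry_le {A : Matrix (Fin d) (Fin d) ℝ} {b : ℝ}
    (hb : ∀ i j, |A i j| ≤ b) (x : Fin d → ℝ) : ‖A.mulVec x‖ ≤ d * b * ‖x‖ := by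
  rcases isEmpty_or_nonempty (Fin d) with hd | ⟨⟨i₀⟩⟩
  · simp [Subsingleton.elim x 0]
  have hb0 : 0 ≤ b := (abs_nonneg _).trans (hb i₀ i₀)
  refine (pi_norm_le_iff_of_nonneg (by positivity)).2 fun i => ?_
  calc ‖A.mulVec x i‖ ≤ ∑ j, ‖A i j * x j‖ := by
        simp only [Matrix.mulVec, dotProduct]
        exact norm_sum_le _ _
    _ ≤ ∑ _j : Fin d, b * ‖x‖ := Finset.sum_le_sum fun j _ => by
        rw [norm_mul]
        exact mul_le_mul (hb i j) (norm_le_pi_norm x j) (norm_nonneg _) hb0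
    _ = d * b * ‖x‖ := by simp [mul_assoc]

theorem measurable_mulVec {α : Type*} {_ : MeasurableSpace α}
    {A : α → Matrix (Fin d) (Fin d) ℝ} {x : α → Fin d → ℝ}
    (hA : ∀ i j, Measurable fun a => A a i j) (hx : Measurable x) :
    Measurable fun a => (A a).mulVec (x a) := by
  refine measurable_pi_lambda _ fun i => ?_
  simp only [Matrix.mulVec, dotProduct]
  exact Finset.measurable_fun_sum _ fun j _ => (hA i j).mul ((measurable_pi_apply j).comp hx)

variable {Φ : ℝ → Ω → Matrix (Fin d) (Fin d) ℝ} {θ : ℝ → Ω → Ω} {f g : ℝ → Ω → Fin d → ℝ}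

theorem measurable_gainOperator_integrand
    (hθ : Measurable fun p : ℝ × Ω => θ p.1 p.2)
    (hΦ : ∀ i j, Measurable fun p : ℝ × Ω => Φ p.1 p.2 i j)
    (hf : Measurable (Function.uncurry f)) :
    Measurable fun p : (ℝ × Ω) × ℝ => (Φ (p.1.1 - p.2) (θ p.2 p.1.2)).mulVec (f p.2 p.1.2) := by
  have hsω : Measurable fun p : (ℝ × Ω) × ℝ => (p.2, p.1.2) :=
    measurable_snd.prodMk (measurable_snd.comp measurable_fst)
  refine measurable_mulVec (fun i j => ?_) (hf.comp hsω)
  exact (hΦ i j).comp (((measurable_fst.comp measurable_fst).sub measurable_snd).prodMk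
    (hθ.comp hsω))

theorem measurable_gainOperator_path (hθ : Measurable fun p : ℝ × Ω => θ p.1 p.2)
    (hΦ : ∀ i j, Measurable fun p : ℝ × Ω => Φ p.1 p.2 i j)
    (hf : Measurable (Function.uncurry f)) (t : ℝ) (ω : Ω) :
    Measurable fun s => (Φ (t - s) (θ s ω)).mulVec (f s ω) :=
  (measurable_gainOperator_integrand hθ hΦ hf).comp (measurable_prodMk_left (x := (t, ω)))

theorem measurable_gainOperator (hθ : Measurable fun p : ℝ × Ω => θ p.1 p.2)
    (hΦ : ∀ i j, Measurable fun p : ℝ × Ω => Φ p.1 p.2 i j)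
    (hf : Measurable (Function.uncurry f)) :
    Measurable (Function.uncurry (gainOperator Φ θ f)) := by
  have hset : MeasurableSet {p : (ℝ × Ω) × ℝ | p.2 ≤ p.1.1} :=
    measurableSet_le measurable_snd (measurable_fst.comp measurable_fst)
  have := ((measurable_gainOperator_integrand hθ hΦ hf).indicator
    hset).stronglyMeasurable.integral_prod_right' (ν := volume)
  convert! this.measurable using 1
  ext1 p
  rw [Function.uncurry, gainOperator, ← integral_indicator measurableSet_Iic]
  rfl

theorem StronglyMeasurable.integral_left {α β E : Type*} {_ : MeasurableSpace α}
    {_ : MeasurableSpace β} [NormedAddCommGroup E] [NormedSpace ℝ E] {μ : Measure α} [SFinite μ]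
    {φ : α × β → E} (hφ : StronglyMeasurable φ) :
    StronglyMeasurable fun y => ∫ x, φ (x, y) ∂μ :=
  hφ.integral_prod_left'

theorem measurable_gainOperator_filtration {𝓕 : Filtration ℝ mΩ}
    (hΦ : ∀ t : ℝ, ∀ i j, Measurable[MeasurableSpace.prod inferInstance (𝓕 t)]
      fun p : Set.Iic t × Ω => Φ (t - (p.1 : ℝ)) (θ (p.1 : ℝ) p.2) i j)
    (hf : IsStronglyProgressive 𝓕 f) (t : ℝ) :
    Measurable[𝓕 t] (gainOperator Φ θ f t) := by
  have h1 := measurable_mulVec (hΦ t) (hf t).measurable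
  have : SigmaFinite (Measure.comap (Subtype.val : Set.Iic t → ℝ) volume) := by
    refine SigmaFinite.of_map _ measurable_subtype_coe.aemeasurable ?_
    rw [map_comap_subtype_coe measurableSet_Iic]
    infer_instance
  have h2 := StronglyMeasurable.integral_left
    (μ := Measure.comap (Subtype.val : Set.Iic t → ℝ) volume) h1.stronglyMeasurable
  have h3 : gainOperator Φ θ f t = fun ω => ∫ s : Set.Iic t,
      (Φ (t - s) (θ s ω)).mulVec (f s ω) ∂(Measure.comap Subtype.val volume) := by
    ext1 ω
    exact (integral_subtype_comap measurableSet_Iic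
      fun s => (Φ (t - s) (θ s ω)).mulVec (f s ω)).symm
  rw [h3]
  exact h2.measurable

theorem gainOperator_periodic {T : ℝ} (hθ : ∀ s t : ℝ, θ (t + s) = θ t ∘ θ s)
    (hf : ∀ t ω, f (t + T) ω = f t (θ T ω)) (t : ℝ) (ω : Ω) :
    gainOperator Φ θ f (t + T) ω = gainOperator Φ θ f t (θ T ω) := by
  have hmp : MeasurePreserving (fun s : ℝ => s + T) volume volume :=
    measurePreserving_add_right volume T
  have := hmp.setIntegral_preimage_emb (MeasurableEquiv.addRight T).measurableEmbedding
    (fun s => (Φ (t + T - s) (θ s ω)).mulVec (f s ω)) (Set.Iic (t + T))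
  rw [gainOperator, ← this, gainOperator]
  have hpre : (fun s : ℝ => s + T) ⁻¹' Set.Iic (t + T) = Set.Iic t := by
    ext s
    simp
  rw [hpre]
  refine integral_congr_ae (Eventually.of_forall fun s => ?_)
  simp only [hθ, hf, add_sub_add_right_eq_sub, Function.comp_apply]

theorem gainOperator_nonneg (hΦ : ∀ t ω, 0 ≤ t → ∀ i j, 0 ≤ Φ t ω i j)
    (hf : ∀ t ω i, 0 ≤ f t ω i) {t : ℝ} {ω : Ω}
    (hint : IntegrableOn (fun s => (Φ (t - s) (θ s ω)).mulVec (f s ω)) (Set.Iic t)) (i : Fin d) :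
    0 ≤ gainOperator Φ θ f t ω i := by
  rw [gainOperator, eval_integral fun j => hint.eval j]
  refine setIntegral_nonneg measurableSet_Iic fun s hs => ?_
  simp only [Matrix.mulVec, dotProduct]
  refine Finset.sum_nonneg fun j _ => ?_
  exact mul_nonneg (hΦ _ _ (sub_nonneg.2 hs) i j) (hf s ω j)

theorem exists_exp_bound_of_tempered {R : ℝ → Ω → ℝ} {lam : ℝ} (hlam : 0 < lam)
    (hR : ∀ t ω, 0 ≤ t → 0 < R t ω)
    (hΦ : ∀ t ω, 0 ≤ t → ∀ i j, |Φ t ω i j| ≤ R t ω * Real.exp (-lam * t))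
    (htemp : ∀ γ : ℝ, 0 < γ → ∀ ω, ∃ C : ℝ, ∀ t s : ℝ, 0 ≤ s →
      Real.exp (-γ * |t|) * R s (θ t ω) ≤ C) (t : ℝ) (ω : Ω) :
    ∃ B : ℝ, ∀ s ≤ t, ∀ i j, |Φ (t - s) (θ s ω) i j| ≤ B * Real.exp (lam / 2 * s) := by
  obtain ⟨C, hC⟩ := htemp (lam / 2) (half_pos hlam) ω
  have hC0 : 0 ≤ C := le_trans (mul_nonneg (Real.exp_nonneg _) (hR 0 _ le_rfl).le) (hC 0 0 le_rfl)
  refine ⟨C * Real.exp (lam / 2 * |t| - lam / 2 * t), fun s hs i j => ?_⟩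
  have hts : 0 ≤ t - s := sub_nonneg.2 hs
  have hRs : R (t - s) (θ s ω) ≤ C * Real.exp (lam / 2 * |s|) := by
    have := mul_le_mul_of_nonneg_right (hC s (t - s) hts) (Real.exp_nonneg (lam / 2 * |s|))
    rwa [mul_right_comm, ← Real.exp_add, neg_mul, neg_add_cancel, Real.exp_zero, one_mul] at this
  have habs : |s| ≤ |t| + (t - s) := by
    have := abs_sub_abs_le_abs_sub s t
    rw [abs_sub_comm, abs_of_nonneg hts] at this
    linarith
  calc |Φ (t - s) (θ s ω) i j| ≤ R (t - s) (θ s ω) * Real.exp (-lam * (t - s)) :=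
        hΦ _ _ hts i j
    _ ≤ C * Real.exp (lam / 2 * |s|) * Real.exp (-lam * (t - s)) := by gcongr
    _ = C * Real.exp (lam / 2 * |s| - lam * (t - s)) := by
        rw [mul_assoc, ← Real.exp_add]
        ring_nf
    _ ≤ C * Real.exp (lam / 2 * |t| - lam / 2 * t + lam / 2 * s) := by
        gcongr
        nlinarith
    _ = _ := by rw [Real.exp_add, mul_assoc]

theorem norm_gainOperator_integrand_le {a B M : ℝ} {t : ℝ} {ω : Ω}
    (hB : ∀ s ≤ t, ∀ i j, |Φ (t - s) (θ s ω) i j| ≤ B * Real.exp (a * s))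
    (hM : ∀ s, ‖f s ω‖ ≤ M) {s : ℝ} (hs : s ≤ t) :
    ‖(Φ (t - s) (θ s ω)).mulVec (f s ω)‖ ≤ d * B * M * Real.exp (a * s) := by
  refine (norm_mulVec_le_of_entry_le (hB s hs) _).trans ?_
  rcases Nat.eq_zero_or_pos d with rfl | hd
  · simp
  have hb0 := (abs_nonneg _).trans (hB s hs ⟨0, hd⟩ ⟨0, hd⟩)
  calc d * (B * Real.exp (a * s)) * ‖f s ω‖ ≤ d * (B * Real.exp (a * s)) * M := by
        gcongr
        exact hM s
    _ = _ := by ring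

theorem integrableOn_gainOperator {a B M : ℝ} (ha : 0 < a) {t : ℝ} {ω : Ω}
    (hB : ∀ s ≤ t, ∀ i j, |Φ (t - s) (θ s ω) i j| ≤ B * Real.exp (a * s))
    (hM : ∀ s, ‖f s ω‖ ≤ M)
    (hm : Measurable fun s => (Φ (t - s) (θ s ω)).mulVec (f s ω)) :
    IntegrableOn (fun s => (Φ (t - s) (θ s ω)).mulVec (f s ω)) (Set.Iic t) := by
  refine Integrable.mono' ((integrableOn_exp_mul_Iic ha t).const_mul (d * B * M))
    hm.aestronglyMeasurable ?_
  refine (ae_restrict_iff' measurableSet_Iic).2 (Eventually.of_forall fun s hs => ?_)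
  exact norm_gainOperator_integrand_le hB hM hs

theorem tendsto_gainOperator {a B M : ℝ} (ha : 0 < a) {t : ℝ} {ω : Ω}
    {F : ℕ → ℝ → Ω → Fin d → ℝ}
    (hB : ∀ s ≤ t, ∀ i j, |Φ (t - s) (θ s ω) i j| ≤ B * Real.exp (a * s))
    (hM : ∀ n s, ‖F n s ω‖ ≤ M)
    (hm : ∀ n, Measurable fun s => (Φ (t - s) (θ s ω)).mulVec (F n s ω))
    (hlim : ∀ᵐ s, Tendsto (fun n => F n s ω) atTop (𝓝 (f s ω))) :
    Tendsto (fun n => gainOperator Φ θ (F n) t ω) atTop (𝓝 (gainOperator Φ θ f t ω)) := by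
  refine tendsto_integral_of_dominated_convergence
    (fun s => d * B * M * Real.exp (a * s)) (fun n => (hm n).aestronglyMeasurable)
    ((integrableOn_exp_mul_Iic ha t).const_mul (d * B * M)) (fun n => ?_) ?_
  · refine (ae_restrict_iff' measurableSet_Iic).2 (Eventually.of_forall fun s hs => ?_)
    exact norm_gainOperator_integrand_le hB (hM n) hs
  · filter_upwards [ae_restrict_of_ae hlim] with s hs
    exact ((Continuous.matrix_mulVec continuous_const continuous_id).tendsto _).comp hs

theorem ae_ae_of_forall_ae {μ : Measure Ω} [SFinite μ] {P : ℝ × Ω → Prop}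
    (hP : MeasurableSet {p | P p}) (h : ∀ s, ∀ᵐ ω ∂μ, P (s, ω)) :
    ∀ᵐ ω ∂μ, ∀ᵐ s : ℝ, P (s, ω) :=
  (Measure.ae_ae_comm hP).1 (Eventually.of_forall h)

theorem lintegral_exp_mul_sub_Iic {lam : ℝ} (hlam : 0 < lam) (t : ℝ) :
    ∫⁻ s in Set.Iic t, ENNReal.ofReal (Real.exp (-lam * (t - s))) = ENNReal.ofReal (1 / lam) := by
  have hexp : ∀ s, Real.exp (-lam * (t - s)) = Real.exp (-lam * t) * Real.exp (lam * s) := by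
    intro s
    rw [← Real.exp_add]
    ring_nf
  simp only [hexp]
  rw [← ofReal_integral_eq_lintegral_ofReal ((integrableOn_exp_mul_Iic hlam t).const_mul _)
    (Eventually.of_forall fun s => by positivity), integral_const_mul, integral_exp_mul_Iic hlam,
    ← mul_div_assoc, ← Real.exp_add]
  simp

theorem lintegral_enorm_gainOperator_sub_le {μ : Measure Ω} [IsProbabilityMeasure μ]
    {𝓕 : Filtration ℝ mΩ} {𝓖 : ℝ → ℝ → MeasurableSpace Ω} {R : ℝ → Ω → ℝ} {lam S : ℝ}
    (hlam : 0 < lam) (hθ : Measurable fun p : ℝ × Ω => θ p.1 p.2)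
    (hθμ : ∀ t, MeasurePreserving (θ t) μ μ)
    (hRm : Measurable fun p : ℝ × Ω => R p.1 p.2) (hR : ∀ t ω, 0 ≤ t → 0 < R t ω)
    (hΦ : ∀ t ω, 0 ≤ t → ∀ i j, |Φ t ω i j| ≤ R t ω * Real.exp (-lam * t))
    (h𝓖 : ∀ s t, s ≤ t → 𝓖 s t ≤ mΩ)
    (hindep : ∀ s t : ℝ, s ≤ t → ProbabilityTheory.Indep (𝓖 s t) (𝓕 s) μ)
    (hR𝓖 : ∀ s t : ℝ, s ≤ t → Measurable[𝓖 s t] fun ω => R (t - s) (θ s ω))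
    (hRint : ∀ t : ℝ, 0 ≤ t → Integrable (R t) μ)
    (hS : ∀ t, 0 ≤ t → ∫ ω, R t ω ∂μ ≤ S)
    (hf : IsStronglyProgressive 𝓕 f) (hg : IsStronglyProgressive 𝓕 g) {t : ℝ}
    (hfi : ∀ ω, IntegrableOn (fun s => (Φ (t - s) (θ s ω)).mulVec (f s ω)) (Set.Iic t))
    (hgi : ∀ ω, IntegrableOn (fun s => (Φ (t - s) (θ s ω)).mulVec (g s ω)) (Set.Iic t))
    {c : ℝ≥0∞} (hc : ∀ s, ∫⁻ ω, ‖f s ω - g s ω‖ₑ ∂μ ≤ c) :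
    ∫⁻ ω, ‖gainOperator Φ θ f t ω - gainOperator Φ θ g t ω‖ₑ ∂μ
      ≤ ENNReal.ofReal (d * S / lam) * c := by
  have hS0 : 0 ≤ S := (integral_nonneg fun ω => (hR 0 ω le_rfl).le).trans (hS 0 le_rfl)
  have hfg : Measurable fun p : Ω × ℝ => ‖f p.2 p.1 - g p.2 p.1‖ₑ :=
    ((hf.measurable_uncurry.sub hg.measurable_uncurry).comp measurable_swap).enorm
  have hRθ : Measurable fun p : Ω × ℝ => R (t - p.2) (θ p.2 p.1) :=
    hRm.comp ((measurable_const.sub measurable_snd).prodMk (hθ.comp measurable_swap))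
  set k : ℝ → ℝ≥0∞ := fun s => ENNReal.ofReal (d * Real.exp (-lam * (t - s))) with hk
  have hkm : Measurable k := by fun_prop
  have hpath : ∀ ω, ‖gainOperator Φ θ f t ω - gainOperator Φ θ g t ω‖ₑ ≤
      ∫⁻ s in Set.Iic t, k s * (ENNReal.ofReal (R (t - s) (θ s ω)) * ‖f s ω - g s ω‖ₑ) := by
    intro ω
    rw [gainOperator, gainOperator, ← integral_sub (hfi ω) (hgi ω)]
    refine (enorm_integral_le_lintegral_enorm _).trans (setLIntegral_mono' measurableSet_Iic ?_)
    intro s hs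
    have hts : 0 ≤ t - s := sub_nonneg.2 hs
    have hRs := (hR (t - s) (θ s ω) hts).le
    rw [← Matrix.mulVec_sub, ← ofReal_norm, ← ofReal_norm, ← ENNReal.ofReal_mul hRs,
      ← ENNReal.ofReal_mul (by positivity)]
    refine ENNReal.ofReal_le_ofReal ?_
    refine (norm_mulVec_le_of_entry_le (hΦ (t - s) (θ s ω) hts) _).trans (le_of_eq ?_)
    ring
  have hslice : ∀ s ≤ t, ∫⁻ ω, k s * (ENNReal.ofReal (R (t - s) (θ s ω)) * ‖f s ω - g s ω‖ₑ) ∂μ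
      ≤ k s * (ENNReal.ofReal S * c) := by
    intro s hs
    have hts : 0 ≤ t - s := sub_nonneg.2 hs
    have hRs : Measurable fun ω => R (t - s) (θ s ω) := hRθ.comp measurable_prodMk_right
    have hfg𝓕 : Measurable[𝓕 s] fun ω => ‖f s ω - g s ω‖ₑ :=
      StronglyMeasurable.enorm ((hf.stronglyAdapted s).sub (hg.stronglyAdapted s))
    have hfgs : Measurable fun ω => ‖f s ω - g s ω‖ₑ := hfg𝓕.mono (𝓕.le s) le_rfl
    have hRE : ∫⁻ ω, ENNReal.ofReal (R (t - s) (θ s ω)) ∂μ ≤ ENNReal.ofReal S := by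
      have hRts : Measurable (R (t - s)) := hRm.comp measurable_prodMk_left
      rw [(hθμ s).lintegral_comp (f := fun ω => ENNReal.ofReal (R (t - s) ω)) hRts.ennreal_ofReal,
        ← ofReal_integral_eq_lintegral_ofReal (hRint _ hts)
          (Eventually.of_forall fun ω => (hR _ ω hts).le)]
      exact ENNReal.ofReal_le_ofReal (hS _ hts)
    rw [lintegral_const_mul (f := fun ω => ENNReal.ofReal (R (t - s) (θ s ω)) * ‖f s ω - g s ω‖ₑ) _
        (hRs.ennreal_ofReal.mul hfgs),
      ProbabilityTheory.lintegral_mul_eq_lintegral_mul_lintegral_of_independent_measurableSpace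
        (h𝓖 s t hs) (𝓕.le s) (hindep s t hs)
        (hR𝓖 s t hs).ennreal_ofReal hfg𝓕]
    gcongr
    exact hc s
  calc ∫⁻ ω, ‖gainOperator Φ θ f t ω - gainOperator Φ θ g t ω‖ₑ ∂μ
      ≤ ∫⁻ ω, (∫⁻ s in Set.Iic t,
          k s * (ENNReal.ofReal (R (t - s) (θ s ω)) * ‖f s ω - g s ω‖ₑ)) ∂μ := lintegral_mono hpath
    _ = ∫⁻ s in Set.Iic t, ∫⁻ ω,
          k s * (ENNReal.ofReal (R (t - s) (θ s ω)) * ‖f s ω - g s ω‖ₑ) ∂μ :=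
        lintegral_lintegral_swap ((hkm.comp measurable_snd).mul
          (hRθ.ennreal_ofReal.mul hfg)).aemeasurable
    _ ≤ ∫⁻ s in Set.Iic t, k s * (ENNReal.ofReal S * c) :=
        setLIntegral_mono' measurableSet_Iic hslice
    _ = ENNReal.ofReal (d * S / lam) * c := by
        rw [lintegral_mul_const _ hkm]
        simp only [hk, ENNReal.ofReal_mul (Nat.cast_nonneg d)]
        rw [lintegral_const_mul _ (by fun_prop), lintegral_exp_mul_sub_Iic hlam, ← mul_assoc,
          ← ENNReal.ofReal_mul (by positivity), ← ENNReal.ofReal_mul (by positivity)]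
        congr 2
        ring

end GainOperator

theorem norm_sub_le_of_partialDeriv_le {d : ℕ} {F : (Fin d → ℝ) → Fin d → ℝ} {L : ℝ}
    (hL0 : 0 ≤ L) (hF : ∀ x i, DifferentiableAt ℝ (fun y => F y i) x)
    (hL : ∀ x, (∀ j, 0 ≤ x j) → ∀ i j, |fderiv ℝ (fun y => F y i) x (Pi.single j 1)| ≤ L)
    {x y : Fin d → ℝ} (hx : ∀ j, 0 ≤ x j) (hy : ∀ j, 0 ≤ y j) :
    ‖F x - F y‖ ≤ L * d * ‖x - y‖ := by
  refine (pi_norm_le_iff_of_nonneg (by positivity)).2 fun i => ?_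
  refine (convex_Ici (0 : Fin d → ℝ)).norm_image_sub_le_of_norm_fderiv_le
    (f := fun y => F y i) (fun z _ => hF z i) (fun z hz => ?_) hy hx
  refine ContinuousLinearMap.opNorm_le_bound _ (by positivity) fun v => ?_
  rw [← Finset.univ_sum_single v, map_sum]
  calc ‖∑ j, fderiv ℝ (fun y => F y i) z (Pi.single j (v j))‖
      ≤ ∑ j, ‖fderiv ℝ (fun y => F y i) z (Pi.single j (v j))‖ := norm_sum_le _ _
    _ ≤ ∑ _j : Fin d, L * ‖v‖ := Finset.sum_le_sum fun j _ => by
        have : (Pi.single j (v j) : Fin d → ℝ) = v j • Pi.single j 1 := by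
          rw [← Pi.single_smul]
          simp
        rw [this, map_smul, norm_smul, mul_comm]
        exact mul_le_mul (hL z hz i j) (norm_le_pi_norm v j) (norm_nonneg _) hL0
    _ = L * d * ‖∑ j, Pi.single j (v j)‖ := by
        rw [Finset.univ_sum_single]
        simp
        ring

section FixedPoint

variable {Ω : Type*} {mΩ : MeasurableSpace Ω} {d : ℕ} {𝓕 : Filtration ℝ mΩ} {σ : Ω → Ω} {T : ℝ}
  {N : Fin d → ℝ} {μ : Measure Ω} [IsProbabilityMeasure μ]
  {G : (ℝ → Ω → Fin d → ℝ) → ℝ → Ω → Fin d → ℝ} {q : ℝ≥0∞}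

theorem IsAdmissible.lintegral_enorm_sub_le {f g : ℝ → Ω → Fin d → ℝ}
    (hf : IsAdmissible 𝓕 σ T N f) (hg : IsAdmissible 𝓕 σ T N g) (t : ℝ) :
    ∫⁻ ω, ‖f t ω - g t ω‖ₑ ∂μ ≤ ENNReal.ofReal (‖N‖ + ‖N‖) := by
  calc ∫⁻ ω, ‖f t ω - g t ω‖ₑ ∂μ ≤ ∫⁻ _, ENNReal.ofReal (‖N‖ + ‖N‖) ∂μ := by
        refine lintegral_mono fun ω => ?_
        rw [← ofReal_norm]
        exact ENNReal.ofReal_le_ofReal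
          ((norm_sub_le _ _).trans (add_le_add (hf.norm_le t ω) (hg.norm_le t ω)))
    _ = _ := by simp

theorem exists_ae_fixedPoint_of_contraction {f₀ : ℝ → Ω → Fin d → ℝ}
    (hf₀ : IsAdmissible 𝓕 σ T N f₀)
    (hmod : ∀ f, IsAdmissible 𝓕 σ T N f →
      ∃ Y, IsAdmissible 𝓕 σ T N Y ∧ ∀ t, ∀ᵐ ω ∂μ, Y t ω = G f t ω)
    (hq : q < 1)
    (hcontr : ∀ f g, IsAdmissible 𝓕 σ T N f → IsAdmissible 𝓕 σ T N g → ∀ c : ℝ≥0∞,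
      (∀ s, ∫⁻ ω, ‖f s ω - g s ω‖ₑ ∂μ ≤ c) → ∀ t, ∫⁻ ω, ‖G f t ω - G g t ω‖ₑ ∂μ ≤ q * c)
    (hcont : ∀ (F : ℕ → ℝ → Ω → Fin d → ℝ) (f : ℝ → Ω → Fin d → ℝ),
      (∀ n, IsAdmissible 𝓕 σ T N (F n)) → IsAdmissible 𝓕 σ T N f →
      (∀ t, ∀ᵐ ω ∂μ, Tendsto (fun n => F n t ω) atTop (𝓝 (f t ω))) →
      ∀ t, ∀ᵐ ω ∂μ, Tendsto (fun n => G (F n) t ω) atTop (𝓝 (G f t ω))) :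
    ∃ u, IsAdmissible 𝓕 σ T N u ∧ ∀ t, ∀ᵐ ω ∂μ, G u t ω = u t ω := by
  choose! step hstep hstepG using hmod
  set F : ℕ → ℝ → Ω → Fin d → ℝ := fun n => step^[n] f₀
  have hFsucc : ∀ n, F (n + 1) = step (F n) := fun n => Function.iterate_succ_apply' step n f₀
  have hFadm : ∀ n, IsAdmissible 𝓕 σ T N (F n) := by
    intro n
    induction n with
    | zero => exact hf₀
    | succ n ih => exact hFsucc n ▸ hstep _ ih
  have hFG : ∀ n t, ∀ᵐ ω ∂μ, F (n + 1) t ω = G (F n) t ω := fun n t =>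
    hFsucc n ▸ hstepG _ (hFadm n) t
  have hincr : ∀ n t, ∫⁻ ω, ‖F (n + 1) t ω - F n t ω‖ₑ ∂μ
      ≤ q ^ n * ENNReal.ofReal (‖N‖ + ‖N‖) := by
    intro n
    induction n with
    | zero => simpa using (hFadm 1).lintegral_enorm_sub_le (hFadm 0)
    | succ n ih =>
      intro t
      have hae : ∫⁻ ω, ‖F (n + 1 + 1) t ω - F (n + 1) t ω‖ₑ ∂μ
          = ∫⁻ ω, ‖G (F (n + 1)) t ω - G (F n) t ω‖ₑ ∂μ := by
        refine lintegral_congr_ae ?_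
        filter_upwards [hFG n t, hFG (n + 1) t] with ω h₁ h₂
        rw [h₁, h₂]
      rw [hae, pow_succ', mul_assoc]
      exact hcontr _ _ (hFadm (n + 1)) (hFadm n) _ ih t
  have hcauchy : ∀ t, ∀ᵐ ω ∂μ, CauchySeq fun n => F n t ω := by
    refine fun t => ae_cauchySeq_of_tsum_lintegral_enorm_sub (fun n => (hFadm n).measurable t) ?_
    refine ne_top_of_le_ne_top ?_ (ENNReal.tsum_le_tsum fun n => hincr n t)
    rw [ENNReal.tsum_mul_right, ENNReal.tsum_geometric]
    exact ENNReal.mul_ne_top (ENNReal.inv_ne_top.2 (tsub_pos_of_lt hq).ne') ENNReal.ofReal_ne_top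
  obtain ⟨u, hu, hulim⟩ := IsAdmissible.exists_limit hFadm
  have htend : ∀ t, ∀ᵐ ω ∂μ, Tendsto (fun n => F n t ω) atTop (𝓝 (u t ω)) := by
    intro t
    filter_upwards [hcauchy t] with ω hω
    obtain ⟨x, hx⟩ := cauchySeq_tendsto_of_complete hω
    rwa [hulim t ω x hx]
  refine ⟨u, hu, fun t => ?_⟩
  filter_upwards [hcont F u hFadm hu htend t, htend t, ae_all_iff.2 fun n => hFG n t]
    with ω hG hlim hsucc
  refine tendsto_nhds_unique hG ?_
  simpa only [hsucc] using (tendsto_add_atTop_iff_nat 1).2 hlim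

theorem ae_eq_of_ae_fixedPoint_of_contraction {u v : ℝ → Ω → Fin d → ℝ}
    (hu : IsAdmissible 𝓕 σ T N u) (hv : IsAdmissible 𝓕 σ T N v) (hq : q < 1)
    (hcontr : ∀ c : ℝ≥0∞, (∀ s, ∫⁻ ω, ‖u s ω - v s ω‖ₑ ∂μ ≤ c) →
      ∀ t, ∫⁻ ω, ‖G u t ω - G v t ω‖ₑ ∂μ ≤ q * c)
    (hGu : ∀ t, ∀ᵐ ω ∂μ, G u t ω = u t ω) (hGv : ∀ t, ∀ᵐ ω ∂μ, G v t ω = v t ω) (t : ℝ) :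
    u t =ᵐ[μ] v t := by
  set c : ℝ≥0∞ := ⨆ s, ∫⁻ ω, ‖u s ω - v s ω‖ₑ ∂μ
  have hctop : c ≠ ∞ := ne_top_of_le_ne_top ENNReal.ofReal_ne_top
    (iSup_le fun s => hu.lintegral_enorm_sub_le hv s)
  have hcq : c ≤ q * c := by
    refine iSup_le fun s => ?_
    refine le_trans (le_of_eq (lintegral_congr_ae ?_))
      (hcontr c (fun r => le_iSup (fun s => ∫⁻ ω, ‖u s ω - v s ω‖ₑ ∂μ) r) s)
    filter_upwards [hGu s, hGv s] with ω h₁ h₂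
    rw [h₁, h₂]
  have hc0 : c = 0 := by
    by_contra hne
    have := ENNReal.mul_lt_mul_left hne hctop hq
    rw [one_mul] at this
    exact absurd hcq this.not_ge
  have hzero : ∫⁻ ω, ‖u t ω - v t ω‖ₑ ∂μ = 0 :=
    le_antisymm (hc0 ▸ le_iSup (fun s => ∫⁻ ω, ‖u s ω - v s ω‖ₑ ∂μ) t) zero_le
  filter_upwards [(lintegral_eq_zero_iff ((hu.measurable t).sub (hv.measurable t)).enorm).1 hzero]
    with ω hω
  simpa [sub_eq_zero] using hω

end FixedPoint

/-- Existence and uniqueness of the fixed point of the gain operator: under the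
small-gain condition `L·d²·sup_{t≥0} 𝔼[R(t,·)] < λ`, there exists `u ∈ 𝓜` with
`K^h(u)(t,·) = u(t,·)` ℙ-a.s. for every `t ∈ ℝ`, and `u` is unique up to `ρ`:
any `v ∈ 𝓜` with `K^h(v)(t,·) = v(t,·)` ℙ-a.s. for every `t` satisfies `ρ(u,v) = 0`. -/
theorem stmt_4 {Ω : Type*} [mΩ : MeasurableSpace Ω] (ℙ : Measure Ω)
    [IsProbabilityMeasure ℙ]
    (θ : ℝ → Ω → Ω)
    (hθmeas : Measurable fun p : ℝ × Ω => θ p.1 p.2)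
    (hθ0 : θ 0 = id) (hθadd : ∀ s t : ℝ, θ (t + s) = θ t ∘ θ s)
    (hθpres : ∀ t, MeasurePreserving (θ t) ℙ ℙ)
    (d : ℕ) (hd : 1 ≤ d) (lam : ℝ) (hlam : 0 < lam)
    (Φ : ℝ → Ω → Matrix (Fin d) (Fin d) ℝ)
    (hΦmeas : ∀ i j, Measurable fun p : ℝ × Ω => Φ p.1 p.2 i j)
    (hΦpos : ∀ t ω, 0 ≤ t → ∀ i j, 0 ≤ Φ t ω i j)
    (R : ℝ → Ω → ℝ)
    (hRmeas : Measurable fun p : ℝ × Ω => R p.1 p.2)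
    (hRpos : ∀ t ω, 0 ≤ t → 0 < R t ω)
    (hΦbound : ∀ t ω, 0 ≤ t → ∀ i j, |Φ t ω i j| ≤ R t ω * Real.exp (-lam * t))
    (hRtemp : ∀ γ : ℝ, 0 < γ → ∀ ω, ∃ C : ℝ, ∀ t s : ℝ, 0 ≤ s →
      Real.exp (-γ * |t|) * R s (θ t ω) ≤ C)
    (K : (ℝ → Ω → (Fin d → ℝ)) → ℝ → Ω → (Fin d → ℝ))
    (hK : ∀ v t ω, K v t ω = ∫ s in Set.Iic t, (Φ (t - s) (θ s ω)).mulVec (v s ω))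
    (T : ℝ) (hT : 0 < T)
    (h : ℝ → (Fin d → ℝ) → (Fin d → ℝ))
    (hhcont : Continuous fun p : ℝ × (Fin d → ℝ) => h p.1 p.2)
    (hhdiff : ∀ t x i, DifferentiableAt ℝ (fun y => h t y i) x)
    (hhpos : ∀ t x, (∀ i, 0 ≤ x i) → ∀ i, 0 ≤ h t x i)
    (N : Fin d → ℝ)
    (hhbdd : ∀ t x, (∀ j, 0 ≤ x j) → ∀ i, |h t x i| ≤ N i)
    (hhper : ∀ t x, h (t + T) x = h t x)
    (L : ℝ) (hL0 : 0 ≤ L)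
    (hLbound : ∀ t x, (∀ j, 0 ≤ x j) → ∀ i j,
      |fderiv ℝ (fun y => h t y i) x (Pi.single j 1)| ≤ L)
    (𝓕 : Filtration ℝ mΩ)
    (hΦadapt : ∀ s t : ℝ, s ≤ t → ∀ i j,
      Measurable[𝓕 t] fun ω => Φ (t - s) (θ s ω) i j)
    (hΦprog : ∀ t : ℝ, ∀ i j,
      Measurable[MeasurableSpace.prod inferInstance (𝓕 t)]
        fun p : Set.Iic t × Ω => Φ (t - (p.1 : ℝ)) (θ (p.1 : ℝ) p.2) i j)
    (𝓕st : ℝ → ℝ → MeasurableSpace Ω)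
    (h𝓕st_le : ∀ s t : ℝ, s ≤ t → 𝓕st s t ≤ 𝓕 t)
    (hindep : ∀ s t : ℝ, s ≤ t → ProbabilityTheory.Indep (𝓕st s t) (𝓕 s) ℙ)
    (hRadapt : ∀ s t : ℝ, s ≤ t → Measurable[𝓕st s t] fun ω => R (t - s) (θ s ω))
    (hRint : ∀ t : ℝ, 0 ≤ t → Integrable (R t) ℙ)
    (S : ℝ) (hS : IsLUB {y : ℝ | ∃ t : ℝ, 0 ≤ t ∧ y = ∫ ω, R t ω ∂ℙ} S)
    (Mmem : (ℝ → Ω → (Fin d → ℝ)) → Prop)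
    (hMmem : ∀ f, Mmem f ↔
      (ProgMeasurable 𝓕 f ∧ (∀ t ω i, 0 ≤ f t ω i ∧ f t ω i ≤ N i) ∧
        ∀ t ω, f (t + T) ω = f t (θ T ω)))
    (ρ : (ℝ → Ω → (Fin d → ℝ)) → (ℝ → Ω → (Fin d → ℝ)) → ℝ)
    (hρ : ∀ f₁ f₂, ρ f₁ f₂ = ⨆ t : ℝ, ∫ ω, (⨆ i : Fin d, |f₁ t ω i - f₂ t ω i|) ∂ℙ) :
    L * (d : ℝ) ^ 2 * S < lam →
    ∃ u, Mmem u ∧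
      (∀ t : ℝ, ∀ᵐ ω ∂ℙ, h t (K u t ω) = u t ω) ∧
      ∀ v, Mmem v → (∀ t : ℝ, ∀ᵐ ω ∂ℙ, h t (K v t ω) = v t ω) → ρ u v = 0 := by
  intro hsmall
  obtain rfl : K = gainOperator Φ θ := funext fun v => funext fun t => funext fun ω => hK v t ω
  have hSle : ∀ t, 0 ≤ t → ∫ ω, R t ω ∂ℙ ≤ S := fun t ht => hS.1 ⟨t, ht, rfl⟩
  have hadm : ∀ f, Mmem f ↔ IsAdmissible 𝓕 (θ T) T N f := fun f => (hMmem f).trans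
    ⟨fun ⟨h₁, h₂, h₃⟩ => ⟨h₁, fun t ω i => (h₂ t ω i).1, fun t ω i => (h₂ t ω i).2, h₃⟩,
      fun hf => ⟨hf.progressive, fun t ω i => ⟨hf.nonneg t ω i, hf.le_bound t ω i⟩, hf.periodic⟩⟩
  have hN0 : ∀ i, 0 ≤ N i := fun i =>
    (abs_nonneg _).trans (hhbdd 0 0 (fun _ => le_rfl) i)
  have hexp := exists_exp_bound_of_tempered (Φ := Φ) (θ := θ) hlam hRpos hΦbound hRtemp
  have hpath : ∀ f, IsAdmissible 𝓕 (θ T) T N f → ∀ t ω,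
      Measurable fun s => (Φ (t - s) (θ s ω)).mulVec (f s ω) := fun f hf =>
    measurable_gainOperator_path hθmeas hΦmeas hf.progressive.measurable_uncurry
  have hint : ∀ f, IsAdmissible 𝓕 (θ T) T N f → ∀ t ω,
      IntegrableOn (fun s => (Φ (t - s) (θ s ω)).mulVec (f s ω)) (Set.Iic t) := by
    intro f hf t ω
    obtain ⟨B, hB⟩ := hexp t ω
    exact integrableOn_gainOperator (half_pos hlam) hB (fun s => hf.norm_le s ω) (hpath f hf t ω)
  have hpos : ∀ f, IsAdmissible 𝓕 (θ T) T N f → ∀ t ω i, 0 ≤ gainOperator Φ θ f t ω i :=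
    fun f hf t ω => gainOperator_nonneg hΦpos hf.nonneg (hint f hf t ω)
  have hht : ∀ t, Continuous (h t) := fun t => hhcont.comp (Continuous.prodMk_right t)
  have hmod : ∀ f, IsAdmissible 𝓕 (θ T) T N f → ∃ Y, IsAdmissible 𝓕 (θ T) T N Y ∧
      ∀ t, ∀ᵐ ω ∂ℙ, Y t ω = h t (gainOperator Φ θ f t ω) := by
    intro f hf
    refine exists_admissible_modification hT
      (hhcont.measurable.comp (measurable_fst.prodMk
        (measurable_gainOperator hθmeas hΦmeas hf.progressive.measurable_uncurry)))
      (fun t => (hht t).measurable.comp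
        (measurable_gainOperator_filtration hΦprog hf.progressive t))
      (fun t ω => hhpos t _ (hpos f hf t ω))
      (fun t ω i => (le_abs_self _).trans (hhbdd t _ (hpos f hf t ω) i)) (hθpres T)
      fun t ω => ?_
    rw [hhper, gainOperator_periodic hθadd hf.periodic]
  have hq : ENNReal.ofReal (L * d) * ENNReal.ofReal (d * S / lam) < 1 := by
    rw [← ENNReal.ofReal_mul (by positivity), ENNReal.ofReal_lt_one]
    calc L * d * (d * S / lam) = L * (d : ℝ) ^ 2 * S / lam := by ring
      _ < 1 := (div_lt_one hlam).2 hsmall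
  have hcontr : ∀ f g, IsAdmissible 𝓕 (θ T) T N f → IsAdmissible 𝓕 (θ T) T N g → ∀ c : ℝ≥0∞,
      (∀ s, ∫⁻ ω, ‖f s ω - g s ω‖ₑ ∂ℙ ≤ c) → ∀ t,
      ∫⁻ ω, ‖h t (gainOperator Φ θ f t ω) - h t (gainOperator Φ θ g t ω)‖ₑ ∂ℙ
        ≤ ENNReal.ofReal (L * d) * ENNReal.ofReal (d * S / lam) * c := by
    intro f g hf hg c hc t
    calc ∫⁻ ω, ‖h t (gainOperator Φ θ f t ω) - h t (gainOperator Φ θ g t ω)‖ₑ ∂ℙ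
        ≤ ∫⁻ ω, ENNReal.ofReal (L * d)
            * ‖gainOperator Φ θ f t ω - gainOperator Φ θ g t ω‖ₑ ∂ℙ := by
          refine lintegral_mono fun ω => ?_
          rw [← ofReal_norm, ← ofReal_norm, ← ENNReal.ofReal_mul (by positivity)]
          exact ENNReal.ofReal_le_ofReal (norm_sub_le_of_partialDeriv_le hL0 (hhdiff t)
            (hLbound t) (hpos f hf t ω) (hpos g hg t ω))
      _ = ENNReal.ofReal (L * d)
            * ∫⁻ ω, ‖gainOperator Φ θ f t ω - gainOperator Φ θ g t ω‖ₑ ∂ℙ :=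
          lintegral_const_mul' _ _ ENNReal.ofReal_ne_top
      _ ≤ _ := by
          rw [mul_assoc]
          gcongr
          exact lintegral_enorm_gainOperator_sub_le hlam hθmeas hθpres hRmeas hRpos hΦbound
            (fun s t hst => (h𝓕st_le s t hst).trans (𝓕.le t)) hindep hRadapt hRint hSle
            hf.progressive hg.progressive (hint f hf t) (hint g hg t) hc
  have hcont : ∀ (F : ℕ → ℝ → Ω → Fin d → ℝ) (f : ℝ → Ω → Fin d → ℝ),
      (∀ n, IsAdmissible 𝓕 (θ T) T N (F n)) → IsAdmissible 𝓕 (θ T) T N f →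
      (∀ t, ∀ᵐ ω ∂ℙ, Tendsto (fun n => F n t ω) atTop (𝓝 (f t ω))) →
      ∀ t, ∀ᵐ ω ∂ℙ, Tendsto (fun n => h t (gainOperator Φ θ (F n) t ω)) atTop
        (𝓝 (h t (gainOperator Φ θ f t ω))) := by
    intro F f hF hf hlim t
    have hset : MeasurableSet {p : ℝ × Ω |
        Tendsto (fun n => F n p.1 p.2) atTop (𝓝 (f p.1 p.2))} :=
      measurableSet_tendsto_fun (fun n => (hF n).progressive.measurable_uncurry)
        hf.progressive.measurable_uncurry
    filter_upwards [ae_ae_of_forall_ae hset hlim] with ω hω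
    obtain ⟨B, hB⟩ := hexp t ω
    exact ((hht t).tendsto _).comp (tendsto_gainOperator (half_pos hlam) hB
      (fun n s => (hF n).norm_le s ω) (fun n => hpath _ (hF n) t ω) hω)
  have hzero : IsAdmissible 𝓕 (θ T) T N fun _ _ => 0 :=
    ⟨fun _ => stronglyMeasurable_const, fun _ _ _ => le_rfl, fun _ _ i => hN0 i, fun _ _ => rfl⟩
  obtain ⟨u, hu, hfix⟩ := exists_ae_fixedPoint_of_contraction
    (G := fun f t ω => h t (gainOperator Φ θ f t ω)) hzero hmod hq hcontr hcont
  refine ⟨u, (hadm u).2 hu, hfix, fun v hv hvfix => ?_⟩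
  have hv' := (hadm v).1 hv
  have heq := ae_eq_of_ae_fixedPoint_of_contraction
    (G := fun f t ω => h t (gainOperator Φ θ f t ω)) hu hv' hq (hcontr u v hu hv') hfix hvfix
  have hint0 : ∀ t, ∫ ω, (⨆ i : Fin d, |u t ω i - v t ω i|) ∂ℙ = 0 := by
    refine fun t => integral_eq_zero_of_ae ?_
    filter_upwards [heq t] with ω hω
    simp [hω]
  simp [hρ, hint0]
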